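/- Let G be a connected finite simple graph on vertex set V with n ≥ 2 vertices, let 𝔓 = (I + P_G)/2 be the lazy random walk transition matrix, and let Δ = {(y,y) : y ∈ V}. Let D ⊆ V × V be a set of pairs of vertices each of which has at least one common neighbour in G, and set C* = min{ |N(v) ∩ N(w)| : (v,w) ∈ D } (so C* ≥ 1). Let Q be a row-stochastic matrix on V × V such that: (i) both marginals of each row of Q equal the corresponding row of 𝔓, i.e. Σ_{y₂} Q((x₁,x₂),(y₁,y₂)) = 𝔓(x₁,y₁) and Σ_{y₁} Q((x₁,x₂),(y₁,y₂)) = 𝔓(x₂,y₂) for all x₁, x₂, y₁, y₂; (ii) Q((x,x),(y₁,y₂)) = 0 whenever y₁ ≠ y₂; (iii) for every (v,w) ∈ D with v ≠ w, the one-step coalescence probability satisfies Q((v,w), Δ) ≥ C*/(2(n−1)). Suppose further that there exist a positive integer k and a real A with 0 < A < 1 such that Q^k((x₁,x₂), D ∪ Δ) ≥ A for every (x₁,x₂) ∉ D with x₁ ≠ x₂. Then Gap(G) ≥ C*·A / ((n − 1)(k + 1)). -/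

import Mathlib

open Classical in
/-- Transition matrix of the simple random walk on `G`:
`P v w = 1/deg(v)` if `v ~ w`, else `0`. -/
noncomputable def transitionMatrix {V : Type*} [Fintype V] (G : SimpleGraph V) :
    Matrix V V ℝ :=
  fun v w => if G.Adj v w then ((G.degree v : ℝ))⁻¹ else 0

/-- The second-largest eigenvalue of a matrix with real spectrum: the second-largest
root (with multiplicity) of its characteristic polynomial. -/
noncomputable def lambda2 {V : Type*} [Fintype V] [DecidableEq V] (M : Matrix V V ℝ) : ℝ :=
  (M.charpoly.roots.sort (· ≤ ·)).getD ((M.charpoly.roots.sort (· ≤ ·)).length - 2) 0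

open Classical in
/-- Spectral gap of the random walk on `G`; by convention `0` if some vertex is isolated. -/
noncomputable def spectralGap {V : Type*} [Fintype V] (G : SimpleGraph V) : ℝ :=
  if ∀ v, 0 < G.degree v then 1 - lambda2 (transitionMatrix G) else 0

/-- The lazy random walk transition matrix `𝔓 = (I + P_G)/2`. -/
noncomputable def lazyMatrix {V : Type*} [Fintype V] [DecidableEq V]
    (G : SimpleGraph V) : Matrix V V ℝ :=
  (2 : ℝ)⁻¹ • (1 + transitionMatrix G)

open Matrix in
/-- Two eigenvalues (counted with index) of a Hermitian real matrix are at least `lambda2`. -/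
lemma Matrix.IsHermitian.exists_ne_lambda2_le_eigenvalues {V : Type*} [Fintype V] [DecidableEq V]
    (hV : 2 ≤ Fintype.card V) {S : Matrix V V ℝ} (hS : S.IsHermitian) :
    ∃ i j, i ≠ j ∧ lambda2 S ≤ hS.eigenvalues i ∧ lambda2 S ≤ hS.eigenvalues j := by
  classical
  have hroots : S.charpoly.roots = Multiset.map hS.eigenvalues Finset.univ.val := by
    simpa [Function.comp_def] using hS.roots_charpoly_eq_eigenvalues
  set l := S.charpoly.roots.sort (· ≤ ·) with hl
  have hlen : 2 ≤ l.length := by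
    rw [hl, Multiset.length_sort, hroots]
    simpa using hV
  have hlt : l.length - 2 < l.length := by omega
  have hlam : lambda2 S = l[l.length - 2] := List.getD_eq_getElem l 0 hlt
  have hpw : l.Pairwise (· ≤ ·) := Multiset.pairwise_sort _ _
  have hdrop : ∀ a ∈ l.drop (l.length - 2), lambda2 S ≤ a := by
    intro a ha
    rw [hlam]
    rw [List.drop_eq_getElem_cons hlt, List.mem_cons] at ha
    rcases ha with rfl | ha
    · exact le_rfl
    · have h := hpw.drop (i := l.length - 2)
      rw [List.drop_eq_getElem_cons hlt, List.pairwise_cons] at h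
      exact h.1 a ha
  have hcount : 2 ≤ l.countP (lambda2 S ≤ ·) := by
    calc 2 = (l.drop (l.length - 2)).length := by rw [List.length_drop]; omega
      _ = (l.drop (l.length - 2)).countP (lambda2 S ≤ ·) :=
        (List.countP_eq_length.2 (by simpa using hdrop)).symm
      _ ≤ _ := (List.drop_sublist _ _).countP_le
  have hcard : 2 ≤ (Finset.univ.filter (fun i => lambda2 S ≤ hS.eigenvalues i)).card := by
    have h : Multiset.countP (lambda2 S ≤ ·) S.charpoly.roots = l.countP (lambda2 S ≤ ·) := by
      rw [← Multiset.coe_countP, hl, Multiset.sort_eq]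
    rw [← h, hroots, Multiset.countP_map] at hcount
    exact hcount
  obtain ⟨i, hi, j, hj, hij⟩ := Finset.one_lt_card.1 hcard
  exact ⟨i, j, hij, (Finset.mem_filter.1 hi).2, (Finset.mem_filter.1 hj).2⟩

open Matrix in
/-- A matrix that becomes Hermitian after a diagonal change of basis has a non-constant
eigenvector whose eigenvalue is at least `lambda2`. -/
lemma exists_nonconstant_eigenvector {V : Type*} [Fintype V] [DecidableEq V]
    (hV : 2 ≤ Fintype.card V) (M : Matrix V V ℝ) (s : V → ℝ) (hs : ∀ v, s v ≠ 0)
    (hS : (diagonal s * M * diagonal s⁻¹).IsHermitian) :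
    ∃ (μ : ℝ) (f : V → ℝ), lambda2 M ≤ μ ∧ M *ᵥ f = μ • f ∧ ∃ x y, f x ≠ f y := by
  have hlam : lambda2 (diagonal s * M * diagonal s⁻¹) = lambda2 M := by
    have hone : diagonal s⁻¹ * diagonal s = (1 : Matrix V V ℝ) := by
      rw [diagonal_mul_diagonal, ← diagonal_one]
      congr 1
      ext v
      simp [hs v]
    unfold lambda2
    rw [Matrix.charpoly_mul_comm, ← Matrix.mul_assoc, hone, Matrix.one_mul]
  have heig : ∀ i, M *ᵥ (fun v => (s v)⁻¹ * hS.eigenvectorBasis i v) =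
      hS.eigenvalues i • (fun v => (s v)⁻¹ * hS.eigenvectorBasis i v) := by
    intro i
    ext v
    have h := congrFun (hS.mulVec_eigenvectorBasis i) v
    simp only [mulVec, dotProduct, Pi.smul_apply, smul_eq_mul, mul_diagonal, diagonal_mul,
      Pi.inv_apply] at h ⊢
    rw [mul_left_comm, ← h, Finset.mul_sum]
    refine Finset.sum_congr rfl fun w _ => ?_
    have := hs v
    field_simp
  obtain ⟨i, j, hij, hi, hj⟩ := hS.exists_ne_lambda2_le_eigenvalues hV
  rw [hlam] at hi hj
  by_contra! hcon
  have hci := hcon _ _ hi (heig i)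
  have hcj := hcon _ _ hj (heig j)
  obtain ⟨v₀⟩ : Nonempty V := Fintype.card_pos_iff.1 (by omega)
  have hform : ∀ i, (∀ x y, (s x)⁻¹ * hS.eigenvectorBasis i x = (s y)⁻¹ * hS.eigenvectorBasis i y) →
      ∃ a : ℝ, ∀ v, hS.eigenvectorBasis i v = a * s v := by
    intro i h
    refine ⟨(s v₀)⁻¹ * hS.eigenvectorBasis i v₀, fun v => ?_⟩
    rw [h v₀ v, mul_right_comm, inv_mul_cancel₀ (hs v), one_mul]
  obtain ⟨a, ha⟩ := hform i hci
  obtain ⟨b, hb⟩ := hform j hcj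
  have hinner := orthonormal_iff_ite.1 hS.eigenvectorBasis.orthonormal
  have hii := hinner i i
  have hjj := hinner j j
  have hij' := hinner i j
  simp only [PiLp.inner_apply, ha, hb, if_pos, if_neg hij, RCLike.inner_apply, conj_trivial]
    at hii hjj hij'
  have hfac : ∀ c d : ℝ, ∑ v, d * s v * (c * s v) = c * d * ∑ v, s v ^ 2 := by
    intro c d
    rw [Finset.mul_sum]
    exact Finset.sum_congr rfl fun v _ => by ring
  rw [hfac] at hii hjj hij'
  have : (1 : ℝ) = 0 := by
    calc (1 : ℝ) = (a * a * ∑ v, s v ^ 2) * (b * b * ∑ v, s v ^ 2) := by rw [hii, hjj, one_mul]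
      _ = (a * b * ∑ v, s v ^ 2) ^ 2 := by ring
      _ = 0 := by rw [hij']; ring
  exact one_ne_zero this

open Matrix in
lemma transitionMatrix_symmetrization_isHermitian {V : Type*} [Fintype V] [DecidableEq V]
    (G : SimpleGraph V) [DecidableRel G.Adj] (hdeg : ∀ v, 0 < G.degree v) :
    (diagonal (fun v => √(G.degree v : ℝ)) * transitionMatrix G *
      diagonal (fun v => √(G.degree v : ℝ))⁻¹).IsHermitian := by
  ext v w
  have hsq : ∀ v, √(G.degree v : ℝ) * √(G.degree v : ℝ) = G.degree v :=
    fun v => Real.mul_self_sqrt (Nat.cast_nonneg _)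
  have hpos : ∀ v, 0 < √(G.degree v : ℝ) :=
    fun v => Real.sqrt_pos.2 (Nat.cast_pos.2 (hdeg v))
  have hinv : ∀ v, √(G.degree v : ℝ) * (G.degree v : ℝ)⁻¹ = (√(G.degree v : ℝ))⁻¹ := by
    intro v
    have := (hpos v).ne'
    rw [← div_eq_mul_inv, div_eq_iff (Nat.cast_pos.2 (hdeg v)).ne', ← div_eq_inv_mul,
      eq_div_iff this, hsq]
  simp only [conjTranspose_apply, star_trivial, mul_diagonal, diagonal_mul, Pi.inv_apply,
    transitionMatrix, G.adj_comm w v]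
  split_ifs
  · convert mul_comm (√(G.degree w : ℝ))⁻¹ (√(G.degree v : ℝ))⁻¹ using 1
    · rw [← hinv w]; congr!
    · rw [← hinv v]; congr!
  · simp

open Matrix in
lemma Matrix.mulVec_mono_of_nonneg {ι : Type*} [Fintype ι] {Q : Matrix ι ι ℝ}
    (hQ : ∀ p q, 0 ≤ Q p q) {f g : ι → ℝ} (h : f ≤ g) : Q *ᵥ f ≤ Q *ᵥ g := fun p =>
  Finset.sum_le_sum fun q _ => mul_le_mul_of_nonneg_left (h q) (hQ p q)

open Matrix in
lemma Matrix.pow_mulVec_mono_of_nonneg {ι : Type*} [Fintype ι] [DecidableEq ι] {Q : Matrix ι ι ℝ}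
    (hQ : ∀ p q, 0 ≤ Q p q) (m : ℕ) {f g : ι → ℝ} (h : f ≤ g) : Q ^ m *ᵥ f ≤ Q ^ m *ᵥ g := by
  induction m with
  | zero => simpa using h
  | succ m ih =>
    rw [pow_succ', ← mulVec_mulVec, ← mulVec_mulVec]
    exact mulVec_mono_of_nonneg hQ ih

open Matrix in
lemma Matrix.pow_mulVec_of_mulVec_eq_smul {ι : Type*} [Fintype ι] [DecidableEq ι]
    {Q : Matrix ι ι ℝ} {f : ι → ℝ} {μ : ℝ} (h : Q *ᵥ f = μ • f) (m : ℕ) :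
    Q ^ m *ᵥ f = μ ^ m • f := by
  induction m with
  | zero => simp
  | succ m ih => rw [pow_succ, ← mulVec_mulVec, h, mulVec_smul, ih, smul_smul, pow_succ']

open Matrix in
/-- If a coupling of two copies of a chain coalesces within `m` steps with probability at least
`ε` from every pair of distinct states, then any eigenvalue `μ` of the chain with a non-constant
eigenvector satisfies `μ ^ m ≤ 1 - ε`. -/
lemma eigenvalue_pow_le_of_coupling {V : Type*} [Fintype V] [DecidableEq V] {L : Matrix V V ℝ}
    {Q : Matrix (V × V) (V × V) ℝ} (hQ0 : ∀ p q, 0 ≤ Q p q) (hQrow : ∀ p, ∑ q, Q p q = 1)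
    (hmarg1 : ∀ x₁ x₂ y₁ : V, ∑ y₂ : V, Q (x₁, x₂) (y₁, y₂) = L x₁ y₁)
    (hmarg2 : ∀ x₁ x₂ y₂ : V, ∑ y₁ : V, Q (x₁, x₂) (y₁, y₂) = L x₂ y₂)
    {m : ℕ} {ε : ℝ}
    (hε : ∀ p : V × V, p.1 ≠ p.2 →
      ε ≤ (Q ^ m *ᵥ fun q : V × V => if q.1 = q.2 then (1 : ℝ) else 0) p)
    {μ : ℝ} {f : V → ℝ} (hf : L *ᵥ f = μ • f) (hne : ∃ x y, f x ≠ f y) :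
    μ ^ m ≤ 1 - ε := by
  set F : V × V → ℝ := fun p => f p.1 - f p.2 with hF
  set h : V × V → ℝ := fun q => if q.1 = q.2 then (1 : ℝ) else 0 with hh
  have hQF : Q *ᵥ F = μ • F := by
    ext ⟨x₁, x₂⟩
    have e1 : ∑ q : V × V, Q (x₁, x₂) q * f q.1 = μ * f x₁ := by
      rw [Fintype.sum_prod_type]
      simp_rw [← Finset.sum_mul, hmarg1]
      exact congrFun hf x₁
    have e2 : ∑ q : V × V, Q (x₁, x₂) q * f q.2 = μ * f x₂ := by
      rw [Fintype.sum_prod_type_right]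
      simp_rw [← Finset.sum_mul, hmarg2]
      exact congrFun hf x₂
    simp only [mulVec, dotProduct, hF, mul_sub, Finset.sum_sub_distrib, e1, e2, Pi.smul_apply,
      smul_eq_mul]
  have hQ1 : Q *ᵥ (fun _ => (1 : ℝ)) = (1 : ℝ) • fun _ => (1 : ℝ) := by
    ext p
    simpa [mulVec, dotProduct] using hQrow p
  obtain ⟨x, y, hxy⟩ := hne
  obtain ⟨p, -, hp⟩ := Finset.exists_max_image Finset.univ F ⟨(x, y), Finset.mem_univ _⟩
  have hpos : 0 < F p := by
    rcases lt_or_gt_of_ne hxy with hlt | hlt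
    · exact lt_of_lt_of_le (sub_pos.2 hlt) (hp (y, x) (Finset.mem_univ _))
    · exact lt_of_lt_of_le (sub_pos.2 hlt) (hp (x, y) (Finset.mem_univ _))
  have hpne : p.1 ≠ p.2 := by
    intro he
    simp [hF, he] at hpos
  have hle : F ≤ F p • ((fun _ => (1 : ℝ)) - h) := by
    intro q
    by_cases hq : q.1 = q.2
    · simp [hF, hh, hq]
    · simpa [hh, hq] using hp q (Finset.mem_univ _)
  have key := pow_mulVec_mono_of_nonneg hQ0 m hle p
  rw [pow_mulVec_of_mulVec_eq_smul hQF, mulVec_smul, mulVec_sub,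
    pow_mulVec_of_mulVec_eq_smul hQ1, one_pow, one_smul] at key
  simp only [Pi.smul_apply, Pi.sub_apply, smul_eq_mul] at key
  have h2 := hε p hpne
  rw [mul_comm] at key
  exact (le_of_mul_le_mul_left key hpos).trans (by linarith)

open Matrix in
/-- A sticky coupling that coalesces in one step with probability at least `c` from `D`, and
reaches `D` or the diagonal within `k` steps with probability at least `A`, coalesces within
`k + 1` steps with probability at least `c * A`. -/
lemma coalescence_probability_ge {V : Type*} [Fintype V] [DecidableEq V]
    {D : Set (V × V)} [DecidablePred (· ∈ D)] {Q : Matrix (V × V) (V × V) ℝ}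
    (hQ0 : ∀ p q, 0 ≤ Q p q) (hQrow : ∀ p, ∑ q, Q p q = 1)
    (hdiag : ∀ x y₁ y₂ : V, y₁ ≠ y₂ → Q (x, x) (y₁, y₂) = 0)
    {c : ℝ} (hc0 : 0 ≤ c) (hc1 : c ≤ 1)
    (hcoal : ∀ p ∈ D, p.1 ≠ p.2 → c ≤ ∑ y : V, Q p (y, y))
    {k : ℕ} {A : ℝ} (hA1 : A ≤ 1)
    (hstep : ∀ p : V × V, p ∉ D → p.1 ≠ p.2 →
      A ≤ ∑ q ∈ Finset.univ.filter (fun q : V × V => q ∈ D ∨ q.1 = q.2), (Q ^ k) p q)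
    (p : V × V) (hp : p.1 ≠ p.2) :
    c * A ≤ (Q ^ (k + 1) *ᵥ fun q : V × V => if q.1 = q.2 then (1 : ℝ) else 0) p := by
  set h : V × V → ℝ := fun q => if q.1 = q.2 then (1 : ℝ) else 0 with hh
  have hQh : ∀ p, (Q *ᵥ h) p = ∑ y : V, Q p (y, y) := by
    intro p
    simp [mulVec, dotProduct, Fintype.sum_prod_type, hh]
  have hQh_nonneg : ∀ p, 0 ≤ (Q *ᵥ h) p := fun p => by
    rw [hQh]
    exact Finset.sum_nonneg fun _ _ => hQ0 _ _
  have hQh_diag : ∀ p : V × V, p.1 = p.2 → (Q *ᵥ h) p = 1 := by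
    rintro ⟨x, y⟩ hxy
    obtain rfl : x = y := hxy
    rw [hQh, ← hQrow (x, x), Fintype.sum_prod_type]
    refine Finset.sum_congr rfl fun y₁ _ => ?_
    exact (Finset.sum_eq_single y₁ (fun y₂ _ hy => hdiag x y₁ y₂ hy.symm) (by simp)).symm
  have hsticky : h ≤ Q *ᵥ h := by
    intro q
    by_cases hq : q.1 = q.2
    · rw [hQh_diag q hq]; simp [hh, hq]
    · simpa [hh, hq] using hQh_nonneg q
  have hpow : ∀ m, h ≤ Q ^ m *ᵥ h := by
    intro m
    induction m with
    | zero => simp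
    | succ m ih =>
      rw [pow_succ', ← mulVec_mulVec]
      exact hsticky.trans (mulVec_mono_of_nonneg hQ0 ih)
  by_cases hpD : p ∈ D
  · calc c * A ≤ c := mul_le_of_le_one_right hc0 hA1
      _ ≤ (Q *ᵥ h) p := by rw [hQh]; exact hcoal p hpD hp
      _ ≤ _ := by
        rw [pow_succ', ← mulVec_mulVec]
        exact mulVec_mono_of_nonneg hQ0 (hpow k) p
  · have hle : c • (fun q : V × V => if q ∈ D ∨ q.1 = q.2 then (1 : ℝ) else 0) ≤ Q *ᵥ h := by
      intro q
      by_cases hq : q.1 = q.2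
      · rw [hQh_diag q hq]; simpa [hq] using hc1
      · by_cases hqD : q ∈ D
        · rw [hQh]; simpa [hqD] using hcoal q hqD hq
        · simpa [hq, hqD] using hQh_nonneg q
    calc c * A ≤ c * ∑ q ∈ Finset.univ.filter (fun q : V × V => q ∈ D ∨ q.1 = q.2), (Q ^ k) p q :=
          mul_le_mul_of_nonneg_left (hstep p hpD hp) hc0
      _ = (Q ^ k *ᵥ (c • (fun q : V × V => if q ∈ D ∨ q.1 = q.2 then (1 : ℝ) else 0))) p := by
        rw [mulVec_smul, Pi.smul_apply, smul_eq_mul]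
        simp [mulVec, dotProduct, Finset.sum_filter]
      _ ≤ (Q ^ k *ᵥ (Q *ᵥ h)) p := pow_mulVec_mono_of_nonneg hQ0 k hle p
      _ = _ := by rw [mulVec_mulVec, pow_succ]

open Classical in
/-- **Theorem 2.1.** Let `D` be a set of pairs of vertices with at least one common
neighbour, `C* = min{|N(v) ∩ N(w)| : (v,w) ∈ D}`, and let `Q` be a Markovian coupling
of two copies of the lazy walk which sticks together on the diagonal `Δ`, coalesces in
one step from a pair in `D` with probability at least `C*/(2(n-1))`, and from every
pair outside `D` reaches `D ∪ Δ` in `k` steps with probability at least `A`. Then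
`Gap(G) ≥ C*·A/((n-1)(k+1))`. -/
theorem gap_of_common_neighbour_coupling {V : Type*} [Fintype V] (G : SimpleGraph V)
    (hconn : G.Connected) (hn : 2 ≤ Fintype.card V)
    (D : Set (V × V))
    (hD : ∀ p ∈ D, (G.neighborFinset p.1 ∩ G.neighborFinset p.2).Nonempty)
    (C : ℕ)
    (hC : C = sInf {c : ℕ | ∃ p ∈ D, (G.neighborFinset p.1 ∩ G.neighborFinset p.2).card = c})
    (Q : Matrix (V × V) (V × V) ℝ)
    (hQ0 : ∀ p q, 0 ≤ Q p q)
    (hQrow : ∀ p, ∑ q, Q p q = 1)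
    (hmarg1 : ∀ x₁ x₂ y₁ : V, ∑ y₂ : V, Q (x₁, x₂) (y₁, y₂) = lazyMatrix G x₁ y₁)
    (hmarg2 : ∀ x₁ x₂ y₂ : V, ∑ y₁ : V, Q (x₁, x₂) (y₁, y₂) = lazyMatrix G x₂ y₂)
    (hdiag : ∀ x y₁ y₂ : V, y₁ ≠ y₂ → Q (x, x) (y₁, y₂) = 0)
    (hcoal : ∀ p ∈ D, p.1 ≠ p.2 →
      (C : ℝ) / (2 * ((Fintype.card V : ℝ) - 1)) ≤ ∑ y : V, Q p (y, y))
    (k : ℕ) (hk : 0 < k) (A : ℝ) (hA0 : 0 < A) (hA1 : A < 1)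
    (hstep : ∀ p : V × V, p ∉ D → p.1 ≠ p.2 →
      A ≤ ∑ q ∈ Finset.univ.filter (fun q : V × V => q ∈ D ∨ q.1 = q.2), (Q ^ k) p q) :
    (C : ℝ) * A / (((Fintype.card V : ℝ) - 1) * (k + 1)) ≤ spectralGap G := by
  have : Nontrivial V := Fintype.one_lt_card_iff_nontrivial.1 hn
  have hdeg : ∀ v, 0 < G.degree v := fun v => hconn.preconnected.degree_pos_of_nontrivial v
  have hn1 : (0 : ℝ) < (Fintype.card V : ℝ) - 1 := by
    have : (2 : ℝ) ≤ Fintype.card V := by exact_mod_cast hn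
    linarith
  have hCn : (C : ℝ) ≤ (Fintype.card V : ℝ) - 1 := by
    rcases D.eq_empty_or_nonempty with rfl | ⟨p, hp⟩
    · have : C = 0 := by simp [hC]
      simpa [this] using hn1.le
    · have h1 : C ≤ (G.neighborFinset p.1 ∩ G.neighborFinset p.2).card := by
        rw [hC]
        exact Nat.sInf_le ⟨p, hp, rfl⟩
      have h2 : (G.neighborFinset p.1 ∩ G.neighborFinset p.2).card ≤ G.degree p.1 :=
        (Finset.card_le_card Finset.inter_subset_left).trans_eq (G.card_neighborFinset_eq_degree _)
      have h3 : C + 1 ≤ Fintype.card V := (h1.trans h2).trans_lt (G.degree_lt_card_verts p.1)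
      have h4 : (C : ℝ) + 1 ≤ Fintype.card V := by exact_mod_cast h3
      linarith
  set c : ℝ := (C : ℝ) / (2 * ((Fintype.card V : ℝ) - 1)) with hc
  have hc0 : 0 ≤ c := by positivity
  have hc1 : c ≤ 1 := by
    rw [hc, div_le_one (by positivity)]
    linarith
  obtain ⟨μ, f, hμ, hf, hne⟩ := exists_nonconstant_eigenvector hn (transitionMatrix G) _
    (fun v => (Real.sqrt_pos.2 (Nat.cast_pos.2 (hdeg v))).ne')
    (transitionMatrix_symmetrization_isHermitian G hdeg)
  have hlazy : (lazyMatrix G).mulVec f = ((1 + μ) / 2) • f := by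
    rw [lazyMatrix, Matrix.smul_mulVec, Matrix.add_mulVec, Matrix.one_mulVec, hf]
    ext v
    simp only [Pi.smul_apply, Pi.add_apply, smul_eq_mul]
    ring
  have hbound : ((1 + μ) / 2) ^ (k + 1) ≤ 1 - c * A :=
    eigenvalue_pow_le_of_coupling hQ0 hQrow hmarg1 hmarg2
      (coalescence_probability_ge hQ0 hQrow hdiag hc0 hc1 hcoal hA1.le hstep) hlazy hne
  have hk1 : (0 : ℝ) < (k : ℝ) + 1 := by positivity
  have hcA : c * A ≤ 1 := mul_le_one₀ hc1 hA0.le hA1.le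
  have hquot : c * A / (k + 1) ≤ 1 :=
    (div_le_one hk1).2 (by linarith [(Nat.cast_nonneg k : (0 : ℝ) ≤ k)])
  have hgap : (1 + μ) / 2 ≤ 1 - c * A / (k + 1) := by
    by_contra! hcon
    have hlt := pow_lt_pow_left₀ hcon (by linarith) k.succ_ne_zero
    have hbern := one_add_mul_le_pow (a := -(c * A / (k + 1))) (by linarith) (k + 1)
    have hcancel : ((k + 1 : ℕ) : ℝ) * -(c * A / (k + 1)) = -(c * A) := by
      push_cast
      field_simp
    rw [hcancel, ← sub_eq_add_neg, ← sub_eq_add_neg] at hbern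
    exact absurd hbound (not_le.2 (hbern.trans_lt hlt))
  have hrw : (C : ℝ) * A / (((Fintype.card V : ℝ) - 1) * (k + 1)) = 2 * (c * A / (k + 1)) := by
    rw [hc]
    field_simp
  have hdeg' : spectralGap G = 1 - lambda2 (transitionMatrix G) := if_pos hdeg
  rw [hrw]
  linarith
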